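/- Let 1 < q < ∞ (or q = ∞, interpreting ℓ_∞ as c₀) and suppose a Banach space X contains a complemented copy of ℓ₁ and a complemented copy of ℓ_q (respectively c₀). Then the algebra L(X) of bounded operators on X admits an uncountable chain of closed two-sided ideals. In particular L(ℓ₁ ⊕ ℓ_q) and L(ℓ₁ ⊕ c₀) admit uncountable chains of closed ideals. -/

import Mathlib

/-- `E` embeds as a complemented subspace of `X`: there are bounded operators
`J : E → X` and `Q : X → E` with `Q ∘ J = id`. -/
def ComplementedCopy (E X : Type*) [NormedAddCommGroup E] [NormedSpace ℝ E]
    [NormedAddCommGroup X] [NormedSpace ℝ X] : Prop :=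
  ∃ (J : E →L[ℝ] X) (Q : X →L[ℝ] E), Q.comp J = ContinuousLinearMap.id ℝ E

/-- A closed (two-sided) ideal of the operator algebra `L(X)`. -/
def IsClosedOperatorIdeal {X : Type*} [NormedAddCommGroup X] [NormedSpace ℝ X]
    (I : Set (X →L[ℝ] X)) : Prop :=
  IsClosed I ∧ (0 : X →L[ℝ] X) ∈ I ∧
    (∀ S ∈ I, ∀ T ∈ I, S + T ∈ I) ∧ (∀ c : ℝ, ∀ T ∈ I, c • T ∈ I) ∧
    ∀ T ∈ I, ∀ A B : X →L[ℝ] X, B.comp (T.comp A) ∈ I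

section auxiliary
open Filter Topology

theorem mazur_aux {K : Type*} [TopologicalSpace K] [CompactSpace K] [T2Space K]
    (f : ℕ → C(K, ℝ)) (hb : ∀ t x, |f t x| ≤ 1)
    (h0 : ∀ x, Tendsto (fun t => f t x) atTop (𝓝 0))
    (Φ : C(K, ℝ) →L[ℝ] ℝ) (hΦ : ∀ g : C(K, ℝ), (∀ x, 0 ≤ g x) → 0 ≤ Φ g) :
    Tendsto (fun t => Φ (f t)) atTop (𝓝 0) := by
  letI : MeasurableSpace K := borel K
  haveI : BorelSpace K := ⟨rfl⟩
  let L : CompactlySupportedContinuousMap K ℝ →ₗ[ℝ] ℝ :=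
    { toFun := fun g => Φ g.toContinuousMap
      map_add' := fun a b => by rw [← map_add]; rfl
      map_smul' := fun a b => by rw [RingHom.id_apply, ← map_smul]; rfl }
  let P : CompactlySupportedContinuousMap K ℝ →ₚ[ℝ] ℝ :=
    PositiveLinearMap.mk₀ L (fun g hg => hΦ _ (fun x => hg x))
  have key : ∀ g : C(K, ℝ), ∫ x, g x ∂(RealRMK.rieszMeasure P) = Φ g := fun g =>
    RealRMK.integral_rieszMeasure P (CompactlySupportedContinuousMap.continuousMapEquiv g)
  have : Tendsto (fun t => ∫ x, f t x ∂(RealRMK.rieszMeasure P)) atTop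
      (𝓝 (∫ x, (0:ℝ) ∂(RealRMK.rieszMeasure P))) := by
    apply MeasureTheory.tendsto_integral_of_dominated_convergence (fun _ => (1:ℝ))
    · intro n
      exact (f n).continuous.aestronglyMeasurable_of_compactSpace
    · exact MeasureTheory.integrable_const _
    · intro n
      exact Eventually.of_forall fun x => hb n x
    · exact Eventually.of_forall fun x => h0 x
  simpa [key] using this

theorem mazur {K : Type*} [TopologicalSpace K] [CompactSpace K] [T2Space K]
    (f : ℕ → C(K, ℝ)) (hb : ∀ t x, |f t x| ≤ 1)
    (h0 : ∀ x, Tendsto (fun t => f t x) atTop (𝓝 0)) {δ : ℝ} (hδ : 0 < δ) :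
    ∃ θ : ℕ →₀ ℝ, (∀ t, 0 ≤ θ t) ∧ θ.sum (fun _ a => a) = 1 ∧
      ∀ x, θ.sum (fun t a => a * f t x) < δ := by
  by_contra hcon
  push Not at hcon
  let U : Set C(K, ℝ) := {g | ∀ x, g x < δ}
  let D0 : Set (ℕ →₀ ℝ) := {θ | (∀ t, 0 ≤ θ t) ∧ Finsupp.linearCombination ℝ (fun _ : ℕ => (1:ℝ)) θ = 1}
  let D : Set C(K, ℝ) := Finsupp.linearCombination ℝ f '' D0
  have hU1 : Convex ℝ U := by
    intro g hg h hh a b ha hb hab x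
    have h1 := hg x
    have h2 := hh x
    simp only [ContinuousMap.add_apply, ContinuousMap.smul_apply, smul_eq_mul]
    rcases eq_or_lt_of_le ha with rfl | ha
    · simp at hab; subst hab; simpa using h2
    · have : b = 1 - a := by linarith
      subst this
      nlinarith [mul_lt_mul_of_pos_left h1 ha, mul_le_mul_of_nonneg_left h2.le hb]
  have hU2 : IsOpen U := by
    have : U = {g : C(K, ℝ) | Set.MapsTo g Set.univ (Set.Iio δ)} := by
      ext g; simp [U, Set.MapsTo]
    rw [this]
    exact ContinuousMap.isOpen_setOf_mapsTo isCompact_univ isOpen_Iio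
  have hD : Convex ℝ D := by
    apply Convex.linear_image
    intro g hg h hh a b ha hb hab
    refine ⟨fun t => ?_, ?_⟩
    · simp only [Finsupp.add_apply, Finsupp.smul_apply, smul_eq_mul]
      have := hg.1 t
      have := hh.1 t
      positivity
    · rw [map_add, map_smul, map_smul, hg.2, hh.2]; simpa using hab
  have hdisj : Disjoint U D := by
    rw [Set.disjoint_left]
    rintro g hg ⟨θ, hθ, rfl⟩
    obtain ⟨x, hx⟩ := hcon θ hθ.1 (by have := hθ.2; simpa [Finsupp.linearCombination_apply] using this)
    have := hg x
    rw [Finsupp.linearCombination_apply, Finsupp.sum, ContinuousMap.sum_apply] at this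
    simp only [ContinuousMap.smul_apply, smul_eq_mul] at this
    rw [Finsupp.sum] at hx
    linarith
  obtain ⟨Φ, u, h1, h2⟩ := geometric_hahn_banach_open hU1 hU2 hD hdisj
  have hu : 0 < u := by
    have := h1 0 (fun x => by simpa using hδ)
    simpa using this
  have hpos : ∀ g : C(K, ℝ), (∀ x, 0 ≤ g x) → 0 ≤ Φ g := by
    intro g hg
    by_contra hneg
    push Not at hneg
    have hc : 0 ≤ u / (- Φ g) := div_nonneg hu.le (by linarith)
    have := h1 (-(u / (- Φ g)) • g) (fun x => by
      simp only [ContinuousMap.smul_apply, smul_eq_mul]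
      nlinarith [mul_nonneg hc (hg x)])
    rw [map_smul, smul_eq_mul] at this
    have h3 : -(u / (- Φ g)) * Φ g = u := by
      have : Φ g ≠ 0 := hneg.ne
      field_simp
    linarith
  have hlim := mazur_aux f hb h0 Φ hpos
  have : u ≤ 0 := by
    refine ge_of_tendsto' hlim (fun t => h2 _ ⟨Finsupp.single t 1, ⟨fun s => ?_, ?_⟩, ?_⟩)
    · by_cases h : s = t
      · subst h; simp
      · simp [Finsupp.single_apply, Ne.symm h]
    · simp
    · simp
  linarith

/-- no infinite set all of whose finite subsets lie in members -/
def WFam (U : Set (Finset ℕ)) : Prop :=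
  ∀ Γ : Set ℕ, Γ.Infinite → ∃ F : Finset ℕ, (F : Set ℕ) ⊆ Γ ∧ ∀ P ∈ U, ¬ F ⊆ P

def Hit (μ : Finset ℕ) (t N : ℕ) : Prop := ∃ j ∈ μ, t ≤ j ∧ j < N

open Classical in
def GG (U : Set (Finset ℕ)) (δ : ℝ) (l : ℕ) (N : ℕ → ℕ) : Prop :=
  ∀ θ : ℕ → ℕ, 0 < ∑ t ∈ Finset.range l, θ t → ∃ μ ∈ U,
    δ * (∑ t ∈ Finset.range l, (θ t : ℝ)) ≤
      ∑ t ∈ (Finset.range l).filter (fun t => Hit μ t (N t)), (θ t : ℝ)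

theorem GG.mono {U : Set (Finset ℕ)} {δ : ℝ} {l l' : ℕ} {N N' : ℕ → ℕ} (h : GG U δ l N)
    (hl : l' ≤ l) (hN : ∀ t < l', N t = N' t) : GG U δ l' N' := by
  classical
  intro θ hθ
  have hsub : Finset.range l' ⊆ Finset.range l := by simpa using hl
  have e1 : ∀ g : ℕ → ℝ, ∑ t ∈ Finset.range l, (if t < l' then g t else 0) = ∑ t ∈ Finset.range l', g t := by
    intro g
    rw [← Finset.sum_filter]
    apply Finset.sum_congr _ (fun _ _ => rfl)
    ext t; simp; omega
  have e2 : ∑ t ∈ Finset.range l, (if t < l' then θ t else 0) = ∑ t ∈ Finset.range l', θ t := by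
    rw [← Finset.sum_filter]
    apply Finset.sum_congr _ (fun _ _ => rfl)
    ext t; simp; omega
  obtain ⟨μ, hμ, h1⟩ := h (fun t => if t < l' then θ t else 0) (by rw [e2]; exact hθ)
  refine ⟨μ, hμ, ?_⟩
  have := e1 (fun t => (θ t : ℝ))
  push_cast at h1
  rw [this] at h1
  refine h1.trans (le_of_eq ?_)
  rw [Finset.sum_filter, Finset.sum_filter, ← e1]
  apply Finset.sum_congr rfl
  intro t ht
  by_cases h : t < l'
  · simp [h, hN t h]
  · simp [h]

theorem ptak {U : Set (Finset ℕ)} (hU : WFam U) {δ : ℝ} (hδ : 0 < δ) (N : ℕ → ℕ)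
    (hG : ∀ l, GG U δ l N) : False := by
  classical
  let ind : Finset ℕ → (ℕ → Bool) := fun P j => decide (j ∈ P)
  let K : Set (ℕ → Bool) := closure (ind '' U)
  haveI : CompactSpace K := isCompact_iff_compactSpace.mp isClosed_closure.isCompact
  have hfin : ∀ x ∈ K, {j | x j = true}.Finite := by
    intro x hx
    by_contra hinf
    obtain ⟨F, hF, hP⟩ := hU _ hinf
    have hopen : IsOpen {y : ℕ → Bool | ∀ j ∈ F, y j = true} := by
      have : {y : ℕ → Bool | ∀ j ∈ F, y j = true} = ⋂ j ∈ F, (fun y : ℕ → Bool => y j) ⁻¹' {true} := by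
        ext; simp
      rw [this]
      exact isOpen_biInter_finset fun j _ => (isOpen_discrete _).preimage (continuous_apply j)
    obtain ⟨y, hy1, P, hPU, rfl⟩ := mem_closure_iff.mp hx _ hopen (fun j hj => hF hj)
    exact hP P hPU (fun j hj => by simpa [ind] using hy1 j hj)
  let f0 : ℕ → (ℕ → Bool) → ℝ := fun t x => if ∃ j, (t ≤ j ∧ j < N t) ∧ x j = true then 1 else 0
  have hcont : ∀ t, Continuous (f0 t) := by
    intro t
    have hcl : IsClopen {x : ℕ → Bool | ∃ j, (t ≤ j ∧ j < N t) ∧ x j = true} := by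
      have : {x : ℕ → Bool | ∃ j, (t ≤ j ∧ j < N t) ∧ x j = true} =
          ⋃ j ∈ Finset.Ico t (N t), (fun y : ℕ → Bool => y j) ⁻¹' {true} := by
        ext; simp
      rw [this]
      exact isClopen_biUnion_finset fun j _ => (isClopen_discrete _).preimage (continuous_apply j)
    exact continuous_const.if (fun a ha => by
      rw [hcl.frontier_eq] at ha; exact absurd ha (by simp)) continuous_const
  let f : ℕ → C(K, ℝ) := fun t => ⟨fun x => f0 t x, (hcont t).comp continuous_subtype_val⟩
  obtain ⟨θ, h0, h1, h2⟩ := mazur f (fun t x => by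
      change |f0 t x| ≤ 1
      simp only [f0]; split_ifs <;> simp)
    (fun x => by
      obtain ⟨M, hM⟩ := (hfin x x.2).bddAbove
      refine tendsto_const_nhds.congr' ?_
      filter_upwards [eventually_gt_atTop M] with t ht
      change 0 = f0 t x
      simp only [f0]
      rw [if_neg]
      rintro ⟨j, hj, hx⟩
      have := hM hx
      omega) (half_pos hδ)
  -- discretise
  obtain ⟨l, hl⟩ : ∃ l, θ.support ⊆ Finset.range l := by
    obtain ⟨M, hM⟩ := θ.support.bddAbove
    exact ⟨M + 1, fun t ht => by have := hM ht; simp; omega⟩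
  obtain ⟨n, hn⟩ := exists_nat_gt ((l : ℝ) / (δ / 2))
  rw [div_lt_iff₀ (half_pos hδ)] at hn
  have hsum1 : ∑ t ∈ Finset.range l, θ t = 1 := by
    rw [← h1, Finsupp.sum_of_support_subset _ hl _ (by simp)]
  have hnpos : (0:ℝ) < n := by
    rcases Nat.eq_zero_or_pos n with h | h
    · subst h
      have : (0:ℝ) ≤ l := by positivity
      simp at hn; linarith
    · exact_mod_cast h
  have hS : (n : ℝ) ≤ ∑ t ∈ Finset.range l, ((⌈n * θ t⌉₊ : ℕ) : ℝ) := by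
    calc (n : ℝ) = ∑ t ∈ Finset.range l, n * θ t := by rw [← Finset.mul_sum, hsum1, mul_one]
      _ ≤ _ := Finset.sum_le_sum fun t _ => Nat.le_ceil _
  obtain ⟨μ, hμ, h3⟩ := hG l (fun t => ⌈n * θ t⌉₊) (by
    have : (0:ℝ) < ∑ t ∈ Finset.range l, ((⌈n * θ t⌉₊ : ℕ) : ℝ) := by linarith
    exact_mod_cast this)
  have h4 := h2 ⟨ind μ, subset_closure ⟨μ, hμ, rfl⟩⟩
  rw [Finsupp.sum_of_support_subset _ hl _ (by simp)] at h4
  have h5 : ∑ t ∈ (Finset.range l).filter (fun t => Hit μ t (N t)), ((⌈n * θ t⌉₊ : ℕ) : ℝ)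
      ≤ n * ∑ t ∈ Finset.range l, θ t * f t ⟨ind μ, subset_closure ⟨μ, hμ, rfl⟩⟩ + l := by
    rw [Finset.sum_filter, Finset.mul_sum]
    have : (l : ℝ) = ∑ t ∈ Finset.range l, (1:ℝ) := by simp
    rw [this, ← Finset.sum_add_distrib]
    apply Finset.sum_le_sum
    intro t _
    change _ ≤ n * (θ t * f0 t (ind μ)) + 1
    have hiff : (∃ j, (t ≤ j ∧ j < N t) ∧ ind μ j = true) ↔ Hit μ t (N t) := by
      simp only [Hit, ind, decide_eq_true_eq]
      constructor
      · rintro ⟨j, h, h'⟩; exact ⟨j, h', h⟩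
      · rintro ⟨j, h, h'⟩; exact ⟨j, h', h⟩
    simp only [f0, hiff]
    split_ifs
    · have := (Nat.ceil_lt_add_one (mul_nonneg hnpos.le (h0 t))).le
      simpa using this
    · simp
  nlinarith [mul_le_mul_of_nonneg_left hS hδ.le, mul_lt_mul_of_pos_left h4 hnpos]

abbrev L1 := lp (fun _ : ℕ => ℝ) 1

section opOf
variable {E : Type*} [NormedAddCommGroup E] [NormedSpace ℝ E] [CompleteSpace E]

theorem l1_hasSum (z : L1) : HasSum (fun n => |z n|) ‖z‖ := by
  have := lp.hasSum_norm (p := 1) (by simp) z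
  simpa using this

theorem opOf_summable (c : ℕ → E) (hc : ∀ n, ‖c n‖ ≤ 1) (z : L1) :
    Summable (fun n => z n • c n) := by
  refine Summable.of_norm_bounded (l1_hasSum z).summable (fun n => ?_)
  rw [norm_smul]
  calc ‖z n‖ * ‖c n‖ ≤ ‖z n‖ * 1 := by gcongr; exact hc n
    _ = |z n| := by simp

theorem opOf_norm (c : ℕ → E) (hc : ∀ n, ‖c n‖ ≤ 1) (z : L1) :
    ‖∑' n, z n • c n‖ ≤ 1 * ‖z‖ := by
  rw [one_mul]
  refine tsum_of_norm_bounded (l1_hasSum z) (fun n => ?_)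
  rw [norm_smul]
  calc ‖z n‖ * ‖c n‖ ≤ ‖z n‖ * 1 := by gcongr; exact hc n
    _ = |z n| := by simp

noncomputable def opOf (c : ℕ → E) (hc : ∀ n, ‖c n‖ ≤ 1) : L1 →L[ℝ] E :=
  LinearMap.mkContinuous
    { toFun := fun z => ∑' n, z n • c n
      map_add' := fun a b => by
        rw [← (opOf_summable c hc a).tsum_add (opOf_summable c hc b)]
        simp [add_smul]
      map_smul' := fun r a => by
        rw [RingHom.id_apply, ← (opOf_summable c hc a).tsum_const_smul]
        simp [mul_smul] } 1 (fun z => opOf_norm c hc z)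

theorem opOf_apply (c : ℕ → E) (hc : ∀ n, ‖c n‖ ≤ 1) (z : L1) :
    opOf c hc z = ∑' n, z n • c n := rfl

theorem opOf_single (c : ℕ → E) (hc : ∀ n, ‖c n‖ ≤ 1) (p : ℕ) :
    opOf c hc (lp.single 1 p (1:ℝ)) = c p := by
  rw [opOf_apply, tsum_eq_single p]
  · simp
  · intro b hb
    simp [hb]

theorem opOf_bound (c : ℕ → E) (hc : ∀ n, ‖c n‖ ≤ 1) (ψ : E →L[ℝ] ℝ) (M : ℝ)
    (hM : ∀ n, |ψ (c n)| ≤ M) (z : L1) : |ψ (opOf c hc z)| ≤ M * ‖z‖ := by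
  rw [opOf_apply, ψ.map_tsum (opOf_summable c hc z)]
  rw [← Real.norm_eq_abs]
  refine tsum_of_norm_bounded ((l1_hasSum z).mul_left M) (fun n => ?_)
  rw [map_smul, norm_smul]
  calc ‖z n‖ * ‖ψ (c n)‖ ≤ ‖z n‖ * M := by gcongr; exact hM n
    _ = M * |z n| := by rw [mul_comm]; rfl
end opOf

noncomputable def tot (θ : ℕ →₀ ℕ) : ℝ := ∑ i ∈ θ.support, (θ i : ℝ)

structure Model (E : Type*) [NormedAddCommGroup E] [NormedSpace ℝ E] where
  κ : ℝ
  hκ : 0 < κ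
  e : ℕ → E
  ξ : ℕ → E →L[ℝ] ℝ
  u : (ℕ →₀ ℕ) → E
  norm_u : ∀ θ, ‖u θ‖ ≤ 1
  tend : ∀ x, Tendsto (fun i => ξ i x) atTop (𝓝 0)
  pair : ∀ θ, θ ≠ 0 → ∑ i ∈ θ.support, ((θ i : ℝ) / tot θ) ^ κ * ξ i (u θ) = 1
  hold : ∀ (θ : ℕ →₀ ℕ) (H : Finset ℕ), H ⊆ θ.support → ∀ x,
    |∑ i ∈ H, ((θ i : ℝ) / tot θ) ^ κ * ξ i x| ≤ ((∑ i ∈ H, (θ i : ℝ)) / tot θ) ^ κ * ‖x‖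
  shrink : ∀ (b : E →L[ℝ] ℝ) (η : ℝ), 0 < η → ∀ t : ℕ, ∃ N0, ∀ N ≥ N0, ∀ θ : ℕ →₀ ℕ,
    (∀ j ∈ θ.support, ¬ (t ≤ j ∧ j < N)) → |b (u θ)| ≤ η + ∑ j ∈ Finset.range t, |b (e j)|

noncomputable def dec : ℕ → (ℕ →₀ ℕ) := (exists_surjective_nat (ℕ →₀ ℕ)).choose
theorem dec_surj : Function.Surjective dec := (exists_surjective_nat (ℕ →₀ ℕ)).choose_spec

section Sop
variable {E : Type*} [NormedAddCommGroup E] [NormedSpace ℝ E] [CompleteSpace E] (M : Model E)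

open Classical in
noncomputable def Model.col (P : Set (Finset ℕ)) (n : ℕ) : E :=
  if ∃ F ∈ P, (dec n).support ⊆ F then M.u (dec n) else 0

theorem Model.norm_col (P : Set (Finset ℕ)) (n : ℕ) : ‖M.col P n‖ ≤ 1 := by
  unfold Model.col
  split_ifs
  · exact M.norm_u _
  · simp

noncomputable def Model.S (P : Set (Finset ℕ)) : L1 →L[ℝ] E := opOf (M.col P) (M.norm_col P)
end Sop

def UU (f : ℕ → Set (Finset ℕ)) (m : ℕ) : Set (Finset ℕ) := {P | ∃ i < m, P ∈ f i}

theorem UU_wf (f : ℕ → Set (Finset ℕ)) (hf : ∀ i, WFam (f i)) (m : ℕ) : WFam (UU f m) := by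
  classical
  intro Γ hΓ
  choose F hF hF' using fun i => hf i Γ hΓ
  refine ⟨(Finset.range m).biUnion F, ?_, ?_⟩
  · intro x hx
    simp only [Finset.coe_biUnion, Set.mem_iUnion] at hx
    obtain ⟨i, _, hi⟩ := hx
    exact hF i hi
  · rintro P ⟨i, him, hP⟩ hsub
    exact hF' i P hP (fun x hx => hsub (Finset.mem_biUnion.mpr ⟨i, by simpa using him, hx⟩))

def node (m : ℕ) (N n : ℕ → ℕ) (t : ℕ) : ℕ :=
  Encodable.encode (m, (List.range t).map N, (List.range (t+1)).map n)

def nodeInv (γ : ℕ) : ℕ × List ℕ × List ℕ := (Encodable.decode γ).getD (0, [], [])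

theorem nodeInv_node (m : ℕ) (N n : ℕ → ℕ) (t : ℕ) :
    nodeInv (node m N n t) = (m, (List.range t).map N, (List.range (t+1)).map n) := by
  simp [nodeInv, node]

def newFam (f : ℕ → Set (Finset ℕ)) : Set (Finset ℕ) :=
  {P | ∃ m l N n, GG (UU f m) (1 / ((m : ℝ) + 1)) l N ∧ P = (Finset.range (l+1)).image (node m N n)}

theorem newFam_wf (f : ℕ → Set (Finset ℕ)) (hf : ∀ i, WFam (f i)) : WFam (newFam f) := by
  classical
  intro Γ hΓ
  by_contra hcon
  push Not at hcon
  have hinj : Set.InjOn (fun γ => (nodeInv γ).2.1.length) Γ := by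
    intro a ha b hb hab
    obtain ⟨P, ⟨m, l, N, n, -, rfl⟩, hP⟩ := hcon {a, b} (by
      intro x hx; simp at hx; rcases hx with rfl | rfl <;> assumption)
    have h1 := hP (show a ∈ ({a, b} : Finset ℕ) by simp)
    have h2 := hP (show b ∈ ({a, b} : Finset ℕ) by simp)
    rw [Finset.mem_image] at h1 h2
    obtain ⟨t, _, rfl⟩ := h1
    obtain ⟨t', _, rfl⟩ := h2
    simp only [nodeInv_node, List.length_map, List.length_range] at hab
    rw [hab]
  have hub : ∀ s, ∃ γ ∈ Γ, s < (nodeInv γ).2.1.length := by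
    intro s
    by_contra h
    push Not at h
    exact hΓ (Set.Finite.of_finite_image ((Set.finite_Iic s).subset (by
      rintro _ ⟨γ, hγ, rfl⟩; exact h γ hγ)) hinj)
  choose g hg hlen using hub
  let N' : ℕ → ℕ := fun s => (nodeInv (g s)).2.1.getD s 0
  have hδ : (0:ℝ) < 1 / (((nodeInv (g 0)).1 : ℝ) + 1) := by positivity
  refine ptak (UU_wf f hf (nodeInv (g 0)).1) hδ N' (fun l => ?_)
  obtain ⟨P, ⟨m, l', N, n, hG, rfl⟩, hP⟩ := hcon ((Finset.range (l+1)).image g) (by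
    intro x hx
    simp only [Finset.coe_image] at hx
    obtain ⟨s, -, rfl⟩ := hx
    exact hg s)
  have hs : ∀ s < l + 1, ∃ t, t < l' + 1 ∧ s < t ∧ node m N n t = g s := by
    intro s hs
    have := hP (Finset.mem_image_of_mem g (by simpa using hs))
    rw [Finset.mem_image] at this
    obtain ⟨t, ht, h⟩ := this
    refine ⟨t, by simpa using ht, ?_, h⟩
    have := hlen s
    rw [← h, nodeInv_node] at this
    simpa using this
  have hm : (nodeInv (g 0)).1 = m := by
    obtain ⟨t, -, -, h⟩ := hs 0 (by omega)
    rw [← h, nodeInv_node]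
  rw [hm]
  refine hG.mono ?_ ?_
  · obtain ⟨t, h1, h2, -⟩ := hs l (by omega)
    omega
  · intro s hsl
    obtain ⟨t, h1, h2, h⟩ := hs s (by omega)
    simp only [N']
    rw [← h, nodeInv_node]
    simp [List.getD, h2]

section core
variable {E : Type*} [NormedAddCommGroup E] [NormedSpace ℝ E]

theorem seq_step (M : Model E) {K : ℕ} (B : Fin K → E →L[ℝ] E) (m : ℕ) (η : ℝ) (hη : 0 < η)
    (x : List ℕ × List ℕ) : ∃ n N : ℕ, ∀ i, ∀ θ : ℕ →₀ ℕ,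
      (∀ j ∈ θ.support, ¬ (x.1.length ≤ j ∧ j < N)) →
      |M.ξ (Encodable.encode (m, x.1, x.2 ++ [n])) (B i (M.u θ))| ≤ η * (1/2) ^ x.1.length := by
  classical
  set t := x.1.length with ht
  have hη' : 0 < η * (1/2) ^ t := by positivity
  have hinj : Function.Injective (fun n : ℕ => Encodable.encode (m, x.1, x.2 ++ [n])) := by
    intro a b hab
    have := Encodable.encode_injective hab
    simpa using this
  have hlim : ∀ i, Tendsto (fun n : ℕ => ∑ j ∈ Finset.range t,
      |M.ξ (Encodable.encode (m, x.1, x.2 ++ [n])) (B i (M.e j))|) atTop (𝓝 0) := by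
    intro i
    have : Tendsto (fun n : ℕ => ∑ j ∈ Finset.range t,
      |M.ξ (Encodable.encode (m, x.1, x.2 ++ [n])) (B i (M.e j))|) atTop
        (𝓝 (∑ j ∈ Finset.range t, |(0:ℝ)|)) := by
      refine tendsto_finsetSum _ (fun j _ => ?_)
      exact ((M.tend (B i (M.e j))).comp hinj.nat_tendsto_atTop).abs
    simpa using this
  have hev : ∀ᶠ n : ℕ in atTop, ∀ i, ∑ j ∈ Finset.range t,
      |M.ξ (Encodable.encode (m, x.1, x.2 ++ [n])) (B i (M.e j))| < η * (1/2) ^ t / 2 := by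
    rw [Filter.eventually_all]
    intro i
    exact (hlim i).eventually (gt_mem_nhds (by positivity))
  obtain ⟨n, hn⟩ := hev.exists
  choose N0 hN0 using fun i => M.shrink ((M.ξ (Encodable.encode (m, x.1, x.2 ++ [n]))).comp (B i))
    (η * (1/2) ^ t / 2) (by positivity) t
  refine ⟨n, Finset.univ.sup N0, fun i θ hθ => ?_⟩
  have h1 := hN0 i _ (Finset.le_sup (f := N0) (Finset.mem_univ i)) θ hθ
  have h2 := hn i
  simp only [ContinuousLinearMap.comp_apply] at h1
  linarith

theorem seq_exists (M : Model E) {K : ℕ} (B : Fin K → E →L[ℝ] E) (m : ℕ) (η : ℝ) (hη : 0 < η) :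
    ∃ N n : ℕ → ℕ, ∀ t i, ∀ θ : ℕ →₀ ℕ, (∀ j ∈ θ.support, ¬ (t ≤ j ∧ j < N t)) →
      |M.ξ (node m N n t) (B i (M.u θ))| ≤ η * (1/2) ^ t := by
  choose n0 N0 h using seq_step M B m η hη
  let st : ℕ → List ℕ × List ℕ := fun t =>
    Nat.rec ([], []) (fun _ s => (s.1 ++ [N0 s], s.2 ++ [n0 s])) t
  have hst : ∀ t, st t = ((List.range t).map (fun t => N0 (st t)),
      (List.range t).map (fun t => n0 (st t))) := by
    intro t
    induction t with
    | zero => rfl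
    | succ t ih =>
      have : st (t+1) = ((st t).1 ++ [N0 (st t)], (st t).2 ++ [n0 (st t)]) := rfl
      rw [this, List.range_succ, List.map_append, List.map_append]
      nth_rewrite 1 [ih]
      nth_rewrite 2 [ih]
      rfl
  refine ⟨fun t => N0 (st t), fun t => n0 (st t), fun t i θ hθ => ?_⟩
  have hlen : (st t).1.length = t := by rw [hst t]; simp
  have := h (st t) i θ (by rw [hlen]; exact hθ)
  rw [hlen] at this
  have hnode : node m (fun t => N0 (st t)) (fun t => n0 (st t)) t =
      Encodable.encode (m, (st t).1, (st t).2 ++ [n0 (st t)]) := by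
    have e1 := congrArg Prod.fst (hst t)
    have e2 := congrArg Prod.snd (hst t)
    simp only at e1 e2
    unfold node
    rw [List.range_succ, List.map_append, ← e1, ← e2]
    rfl
  rw [hnode]
  exact this

theorem node_inj (m : ℕ) (N n : ℕ → ℕ) : Function.Injective (node m N n) := by
  intro a b hab
  have := congrArg (fun γ => (nodeInv γ).2.1.length) hab
  simpa [nodeInv_node] using this

variable [CompleteSpace E]

theorem gg_step (M : Model E) {f : ℕ → Set (Finset ℕ)} {K : ℕ} (k : Fin K → ℕ)
    (B : Fin K → E →L[ℝ] E) (A : Fin K → L1 →L[ℝ] L1) (m : ℕ) (η : ℝ) (hη : 0 < η)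
    (hk : ∀ i, k i < m) (N n : ℕ → ℕ)
    (hNn : ∀ t i, ∀ θ : ℕ →₀ ℕ, (∀ j ∈ θ.support, ¬ (t ≤ j ∧ j < N t)) →
      |M.ξ (node m N n t) (B i (M.u θ))| ≤ η * (1/2) ^ t)
    (hsum : ∑ i, ((1 / ((m:ℝ)+1)) ^ M.κ * ‖B i‖ + 2 * η) * ‖A i‖ < 3/4)
    (hnorm : ‖M.S (newFam f) - ∑ i, (B i).comp ((M.S (f (k i))).comp (A i))‖ < 1/4)
    (l : ℕ) (hl : GG (UU f m) (1 / ((m:ℝ)+1)) l N) :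
    GG (UU f m) (1 / ((m:ℝ)+1)) (l+1) N := by
  classical
  intro θ hθ
  by_contra hcon
  push Not at hcon
  set δ : ℝ := 1 / ((m:ℝ)+1) with hδ
  have hδ0 : 0 < δ := by positivity
  let θ' : ℕ →₀ ℕ := Finsupp.onFinset (Finset.range (l+1)) (fun t => if t < l+1 then θ t else 0)
    (fun t => by simp; tauto)
  have hθ' : ∀ t ∈ Finset.range (l+1), θ' t = θ t := by
    intro t ht
    have := Finset.mem_range.mp ht
    simp only [θ', Finsupp.onFinset_apply, if_pos this]
  have hsub : θ'.support ⊆ Finset.range (l+1) := Finsupp.support_onFinset_subset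
  let nd : ℕ ↪ ℕ := ⟨node m N n, node_inj m N n⟩
  let Θ : ℕ →₀ ℕ := θ'.embDomain nd
  have hΘs : Θ.support = θ'.support.map nd := Finsupp.support_embDomain _ _
  have hΘv : ∀ t, Θ (nd t) = θ' t := fun t => Finsupp.embDomain_apply_self _ _ _
  have htot : tot Θ = ∑ t ∈ Finset.range (l+1), (θ t : ℝ) := by
    unfold tot
    rw [hΘs, Finset.sum_map]
    simp only [hΘv]
    rw [← Finset.sum_congr rfl (fun t ht => by rw [← hθ' t ht] : ∀ t ∈ Finset.range (l+1), (θ t : ℝ) = (θ' t : ℝ)) |>.symm]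
    refine Finset.sum_subset hsub ?_
    intro x _ hx
    simpa using hx
  have hT : 0 < tot Θ := by
    rw [htot]
    exact_mod_cast hθ
  have hΘ0 : Θ ≠ 0 := by
    intro h
    rw [h] at hT
    simp [tot] at hT
  obtain ⟨p, hp⟩ := dec_surj Θ
  have hcolp : M.col (newFam f) p = M.u Θ := by
    unfold Model.col
    rw [hp, if_pos]
    refine ⟨(Finset.range (l+1)).image (node m N n), ⟨m, l, N, n, hl, rfl⟩, ?_⟩
    rw [hΘs]
    intro x hx
    rw [Finset.mem_map] at hx
    obtain ⟨t, ht, rfl⟩ := hx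
    exact Finset.mem_image_of_mem _ (hsub ht)
  let v : E →L[ℝ] ℝ := ∑ i ∈ Θ.support, ((Θ i : ℝ) / tot Θ) ^ M.κ • M.ξ i
  have hv : ∀ x, v x = ∑ i ∈ Θ.support, ((Θ i : ℝ) / tot Θ) ^ M.κ * M.ξ i x := by
    intro x
    simp [v]
  have hv1 : v (M.u Θ) = 1 := by rw [hv, M.pair Θ hΘ0]
  have hvn : ∀ x, |v x| ≤ ‖x‖ := by
    intro x
    have := M.hold Θ Θ.support subset_rfl x
    rw [← hv] at this
    have h1 : (∑ i ∈ Θ.support, (Θ i : ℝ)) / tot Θ = 1 := div_self hT.ne'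
    rw [h1] at this
    simpa using this
  -- column estimate
  have hcolE : ∀ i q, |v (B i (M.col (f (k i)) q))| ≤ δ ^ M.κ * ‖B i‖ + 2 * η := by
    intro i q
    have hpos : 0 ≤ δ ^ M.κ * ‖B i‖ + 2 * η := by positivity
    unfold Model.col
    split_ifs with hF
    swap
    · simpa using hpos
    obtain ⟨μ, hμ, hsubμ⟩ := hF
    have hμ' := hcon μ ⟨k i, hk i, hμ⟩
    set c := B i (M.u (dec q)) with hc
    have hcn : ‖c‖ ≤ ‖B i‖ := by
      calc ‖c‖ ≤ ‖B i‖ * ‖M.u (dec q)‖ := (B i).le_opNorm _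
        _ ≤ ‖B i‖ * 1 := by gcongr; exact M.norm_u _
        _ = _ := mul_one _
    rw [hv, hΘs, Finset.sum_map]
    simp only [hΘv]
    rw [← Finset.sum_filter_add_sum_filter_not θ'.support (fun t => Hit μ t (N t))]
    refine (abs_add_le _ _).trans (add_le_add ?_ ?_)
    · have h := M.hold Θ ((θ'.support.filter (fun t => Hit μ t (N t))).map nd) (by
        rw [hΘs]; exact Finset.map_subset_map.mpr (Finset.filter_subset _ _)) c
      rw [Finset.sum_map, Finset.sum_map] at h
      simp only [hΘv] at h
      refine h.trans ?_
      have h2 : (∑ t ∈ θ'.support.filter (fun t => Hit μ t (N t)), (θ' t : ℝ)) / tot Θ ≤ δ := by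
        rw [div_le_iff₀ hT, htot]
        refine le_trans ?_ hμ'.le
        calc _ ≤ ∑ t ∈ (Finset.range (l+1)).filter (fun t => Hit μ t (N t)), (θ' t : ℝ) :=
              Finset.sum_le_sum_of_subset_of_nonneg (Finset.filter_subset_filter _ hsub)
                (fun _ _ _ => by positivity)
          _ = _ := Finset.sum_congr rfl (fun t ht => by rw [hθ' t (Finset.mem_filter.mp ht).1])
      have h3 : 0 ≤ (∑ t ∈ θ'.support.filter (fun t => Hit μ t (N t)), (θ' t : ℝ)) / tot Θ := by
        positivity
      have := Real.rpow_le_rpow h3 h2 M.hκ.le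
      exact mul_le_mul this hcn (norm_nonneg _) (by positivity)
    · calc _ ≤ ∑ t ∈ θ'.support.filter (fun t => ¬ Hit μ t (N t)),
            |((θ' t : ℝ) / tot Θ) ^ M.κ * M.ξ (nd t) c| := Finset.abs_sum_le_sum_abs _ _
        _ ≤ ∑ t ∈ θ'.support.filter (fun t => ¬ Hit μ t (N t)), η * (1/2) ^ t := by
            refine Finset.sum_le_sum (fun t ht => ?_)
            obtain ⟨ht1, ht2⟩ := Finset.mem_filter.mp ht
            have h1 := hNn t i (dec q) (fun j hj hjt => ht2 ⟨j, hsubμ hj, hjt⟩)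
            have h2 : (θ' t : ℝ) ≤ tot Θ := by
              rw [htot, hθ' t (hsub ht1)]
              exact Finset.single_le_sum (f := fun t => (θ t : ℝ)) (fun _ _ => by positivity)
                (hsub ht1)
            have h3 : ((θ' t : ℝ) / tot Θ) ^ M.κ ≤ 1 :=
              Real.rpow_le_one (by positivity) (by rw [div_le_one hT]; exact h2) M.hκ.le
            have h4 : 0 ≤ ((θ' t : ℝ) / tot Θ) ^ M.κ := by positivity
            rw [abs_mul, abs_of_nonneg h4]
            calc _ ≤ 1 * |M.ξ (nd t) c| := by gcongr
              _ = |M.ξ (nd t) c| := one_mul _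
              _ ≤ _ := h1
        _ ≤ ∑ t ∈ Finset.range (l+1), η * (1/2) ^ t :=
            Finset.sum_le_sum_of_subset_of_nonneg ((Finset.filter_subset _ _).trans hsub)
              (fun _ _ _ => by positivity)
        _ = η * ∑ t ∈ Finset.range (l+1), (1/2 : ℝ) ^ t := by rw [Finset.mul_sum]
        _ ≤ η * 2 := by gcongr; exact sum_geometric_two_le _
        _ = 2 * η := mul_comm _ _
  have hse : ‖(lp.single 1 p (1:ℝ) : L1)‖ = 1 := by
    rw [lp.norm_single (by simp)]; simp
  set ep : L1 := lp.single 1 p (1:ℝ) with hep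
  set R := ∑ i, (B i).comp ((M.S (f (k i))).comp (A i)) with hR
  have hRb : |v (R ep)| < 3/4 := by
    refine lt_of_le_of_lt ?_ hsum
    have : v (R ep) = ∑ i, v (B i (M.S (f (k i)) (A i ep))) := by
      have h0 : R ep = ∑ i, B i (M.S (f (k i)) (A i ep)) := by
        rw [hR, sum_apply]; rfl
      rw [h0, map_sum]
    rw [this]
    refine (Finset.abs_sum_le_sum_abs _ _).trans (Finset.sum_le_sum (fun i _ => ?_))
    have h1 := opOf_bound (M.col (f (k i))) (M.norm_col _) (v.comp (B i)) _ (hcolE i) (A i ep)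
    refine h1.trans ?_
    have h2 : ‖A i ep‖ ≤ ‖A i‖ := by
      have := (A i).le_opNorm ep
      rwa [hse, mul_one] at this
    gcongr
  have hSb : |v ((M.S (newFam f) - R) ep)| < 1/4 := by
    refine ((hvn _).trans ((M.S (newFam f) - R).le_opNorm ep)).trans_lt ?_
    rw [hse, mul_one]; exact hnorm
  have hS1 : v (M.S (newFam f) ep) = 1 := by
    unfold Model.S
    rw [hep, opOf_single, hcolp, hv1]
  rw [sub_apply, map_sub, hS1] at hSb
  rw [abs_lt] at hSb hRb
  linarith [hSb.2, hRb.2]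

theorem core (M : Model E) {f : ℕ → Set (Finset ℕ)} (hf : ∀ i, WFam (f i)) {K : ℕ} (k : Fin K → ℕ)
    (B : Fin K → E →L[ℝ] E) (A : Fin K → L1 →L[ℝ] L1) :
    1/4 ≤ ‖M.S (newFam f) - ∑ i, (B i).comp ((M.S (f (k i))).comp (A i))‖ := by
  by_contra hcon
  push Not at hcon
  have hlim : Tendsto (fun m : ℕ => (1 / ((m:ℝ)+1)) ^ M.κ * ∑ i, ‖B i‖ * ‖A i‖) atTop (𝓝 0) := by
    have := (tendsto_one_div_add_atTop_nhds_zero_nat (𝕜 := ℝ)).rpow_const (p := M.κ) (Or.inr M.hκ.le)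
    rw [Real.zero_rpow M.hκ.ne'] at this
    simpa using this.mul_const (∑ i, ‖B i‖ * ‖A i‖)
  obtain ⟨m, hm1, hm2⟩ := ((hlim.eventually (gt_mem_nhds (show (0:ℝ) < 1/4 by norm_num))).and
    (eventually_gt_atTop (Finset.univ.sup k))).exists
  have ha : 0 ≤ ∑ i, ‖A i‖ := Finset.sum_nonneg (fun _ _ => norm_nonneg _)
  set η : ℝ := 1 / (16 * (∑ i, ‖A i‖ + 1)) with hη
  have hη0 : 0 < η := by positivity
  have hηa : 2 * η * ∑ i, ‖A i‖ ≤ 1/8 := by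
    rw [hη]
    rw [show 2 * (1 / (16 * (∑ i, ‖A i‖ + 1))) * ∑ i, ‖A i‖ = (∑ i, ‖A i‖) / (8 * (∑ i, ‖A i‖ + 1)) by
      field_simp; ring]
    rw [div_le_div_iff₀ (by positivity) (by positivity)]
    linarith
  obtain ⟨N, n, hNn⟩ := seq_exists M B m η hη0
  have hsum : ∑ i, ((1 / ((m:ℝ)+1)) ^ M.κ * ‖B i‖ + 2 * η) * ‖A i‖ < 3/4 := by
    have : ∑ i, ((1 / ((m:ℝ)+1)) ^ M.κ * ‖B i‖ + 2 * η) * ‖A i‖ =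
        (1 / ((m:ℝ)+1)) ^ M.κ * ∑ i, ‖B i‖ * ‖A i‖ + 2 * η * ∑ i, ‖A i‖ := by
      rw [Finset.mul_sum, Finset.mul_sum, ← Finset.sum_add_distrib]
      exact Finset.sum_congr rfl (fun i _ => by ring)
    rw [this]; linarith
  refine ptak (UU_wf f hf m) (show (0:ℝ) < 1 / ((m:ℝ)+1) by positivity) N (fun l => ?_)
  induction l with
  | zero => intro θ h; simp at h
  | succ l ih =>
    exact gg_step M k B A m η hη0
      (fun i => lt_of_le_of_lt (Finset.le_sup (f := k) (Finset.mem_univ i)) hm2) N n hNn hsum hcon l ih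
end core

section models

theorem shrink_aux {β : ℕ → ℝ} {c : (ℕ →₀ ℕ) → ℕ → ℝ} (hc : ∀ θ i, |c θ i| ≤ 1)
    (htail : ∀ ε > 0, ∃ N0 : ℕ, ∀ θ : ℕ →₀ ℕ, ∀ F ⊆ θ.support, (∀ j ∈ F, N0 ≤ j) →
      |∑ j ∈ F, c θ j * β j| ≤ ε) (η : ℝ) (hη : 0 < η) (t : ℕ) :
    ∃ N0, ∀ N ≥ N0, ∀ θ : ℕ →₀ ℕ,
    (∀ j ∈ θ.support, ¬ (t ≤ j ∧ j < N)) →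
      |∑ j ∈ θ.support, c θ j * β j| ≤ η + ∑ j ∈ Finset.range t, |β j| := by
  obtain ⟨N0, hN0⟩ := htail η hη
  refine ⟨N0, fun N hN θ hθ => ?_⟩
  rw [← Finset.sum_filter_add_sum_filter_not θ.support (fun j => j < t), add_comm]
  refine (abs_add_le _ _).trans (add_le_add ?_ ?_)
  · refine hN0 θ _ (Finset.filter_subset _ _) (fun j hj => ?_)
    obtain ⟨h1, h2⟩ := Finset.mem_filter.mp hj
    have := hθ j h1
    omega
  · calc _ ≤ ∑ j ∈ θ.support.filter (fun j => j < t), |c θ j * β j| :=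
          Finset.abs_sum_le_sum_abs _ _
      _ ≤ ∑ j ∈ θ.support.filter (fun j => j < t), |β j| := by
          refine Finset.sum_le_sum (fun j _ => ?_)
          rw [abs_mul]
          exact mul_le_of_le_one_left (abs_nonneg _) (hc θ j)
      _ ≤ _ := Finset.sum_le_sum_of_subset_of_nonneg (fun j hj => by
          simpa using (Finset.mem_filter.mp hj).2) (fun _ _ _ => abs_nonneg _)

theorem vanish_aux {g : ℕ → ℝ} (hg : Summable g) (ε : ℝ) (hε : 0 < ε) :
    ∃ N0 : ℕ, ∀ F : Finset ℕ, (∀ j ∈ F, N0 ≤ j) → |∑ j ∈ F, g j| < ε := by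
  obtain ⟨s, hs⟩ := summable_iff_vanishing_norm.mp hg ε hε
  refine ⟨s.sup id + 1, fun F hF => hs F ?_⟩
  rw [Finset.disjoint_left]
  intro a ha has
  have h1 := hF a ha
  have h2 : a ≤ s.sup id := Finset.le_sup (f := id) has
  omega

theorem tot_le (θ : ℕ →₀ ℕ) (i : ℕ) : (θ i : ℝ) ≤ tot θ := by
  by_cases h : i ∈ θ.support
  · exact Finset.single_le_sum (f := fun t => (θ t : ℝ)) (fun _ _ => by positivity) h
  · have : θ i = 0 := by simpa using h
    rw [this]
    simp [tot]
    positivity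

theorem tot_nonneg (θ : ℕ →₀ ℕ) : 0 ≤ tot θ := by unfold tot; positivity

theorem tot_pos (θ : ℕ →₀ ℕ) (h : θ ≠ 0) : 0 < tot θ := by
  obtain ⟨i, hi⟩ := Finsupp.ne_iff.mp h
  refine lt_of_lt_of_le ?_ (tot_le θ i)
  have : 0 < θ i := Nat.pos_of_ne_zero (by simpa using hi)
  exact_mod_cast this

theorem frac_nonneg (θ : ℕ →₀ ℕ) (i : ℕ) : 0 ≤ (θ i : ℝ) / tot θ :=
  div_nonneg (by positivity) (tot_nonneg θ)

theorem frac_le_one (θ : ℕ →₀ ℕ) (i : ℕ) : (θ i : ℝ) / tot θ ≤ 1 :=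
  div_le_one_of_le₀ (tot_le θ i) (tot_nonneg θ)

theorem frac_sum_le (θ : ℕ →₀ ℕ) (H : Finset ℕ) (hH : H ⊆ θ.support) :
    ∑ i ∈ H, (θ i : ℝ) / tot θ ≤ 1 := by
  rw [← Finset.sum_div]
  refine div_le_one_of_le₀ ?_ (tot_nonneg θ)
  exact Finset.sum_le_sum_of_subset_of_nonneg hH (fun _ _ _ => by positivity)

theorem rpow_inv_cancel {x s : ℝ} (hx : 0 ≤ x) (hs : 0 < s) : |x ^ (1/s)| ^ s = x := by
  rw [abs_of_nonneg (by positivity), ← Real.rpow_mul hx, one_div_mul_cancel hs.ne', Real.rpow_one]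

theorem model_lp (q : ENNReal) (hq1 : 1 < q) (hq : q < ⊤) [Fact (1 ≤ q)] :
    Nonempty (Model (lp (fun _ : ℕ => ℝ) q)) := by
  classical
  set r := q.toReal with hr
  have hr1 : 1 < r := by
    have := (ENNReal.toReal_lt_toReal (by simp) hq.ne).mpr hq1
    simpa using this
  have hr0 : 0 < q.toReal := by linarith
  set s := r.conjExponent with hs
  have hconj : r.HolderConjugate s := Real.HolderConjugate.conjExponent hr1
  have hs0 : 0 < s := hconj.symm.pos
  let e : ℕ → lp (fun _ : ℕ => ℝ) q := fun i => lp.single q i (1:ℝ)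
  have hsm : ∀ (a : ℝ) i, a • e i = lp.single q i a := by
    intro a i
    simp only [e]
    rw [← lp.single_smul]; simp
  let ξ : ℕ → lp (fun _ : ℕ => ℝ) q →L[ℝ] ℝ := fun i => lp.evalCLM ℝ (fun _ : ℕ => ℝ) q i
  have hξ : ∀ i x, ξ i x = x i := fun i x => rfl
  let c : (ℕ →₀ ℕ) → ℕ → ℝ := fun θ i => ((θ i : ℝ) / tot θ) ^ (1/r)
  have hc0 : ∀ θ i, 0 ≤ c θ i := fun θ i => Real.rpow_nonneg (frac_nonneg θ i) _
  have hcr : ∀ θ i, |c θ i| ^ r = (θ i : ℝ) / tot θ := fun θ i =>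
    rpow_inv_cancel (frac_nonneg θ i) hr0
  let u : (ℕ →₀ ℕ) → lp (fun _ : ℕ => ℝ) q := fun θ => ∑ i ∈ θ.support, c θ i • e i
  have hcoord : ∀ (F : Finset ℕ) (a : ℕ → ℝ) j, j ∈ F → ξ j (∑ i ∈ F, a i • e i) = a j := by
    intro F a j hj
    rw [map_sum, Finset.sum_eq_single j]
    · rw [map_smul, hξ]; simp [e]
    · intro i _ hij
      rw [map_smul, hξ]; simp [e, Pi.single_eq_of_ne hij.symm]
    · exact fun h => absurd hj h
  have hnorm : ∀ (F : Finset ℕ) (a : ℕ → ℝ), ‖∑ i ∈ F, a i • e i‖ ^ r = ∑ i ∈ F, |a i| ^ r := by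
    intro F a
    simp only [hsm]
    exact lp.norm_sum_single hr0 a F
  have hbs : ∀ b : lp (fun _ : ℕ => ℝ) q →L[ℝ] ℝ, Summable (fun i => |b (e i)| ^ s) := by
    intro b
    refine summable_of_sum_le (c := ‖b‖ ^ s) (fun i => by positivity) (fun F => ?_)
    set A := ∑ i ∈ F, |b (e i)| ^ s with hA
    have hA0 : 0 ≤ A := by positivity
    let a : ℕ → ℝ := fun i => SignType.sign (b (e i)) * |b (e i)| ^ (s - 1)
    have h1 : b (∑ i ∈ F, a i • e i) = A := by
      rw [map_sum]
      refine Finset.sum_congr rfl (fun i _ => ?_)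
      rw [map_smul, smul_eq_mul]
      simp only [a]
      rw [mul_right_comm, mul_comm (SignType.sign (b (e i)) : ℝ), self_mul_sign]
      rcases eq_or_ne (b (e i)) 0 with h | h
      · rw [h]; simp [hs0.ne']
      · have : 0 < |b (e i)| := abs_pos.mpr h
        nth_rewrite 1 [← Real.rpow_one |b (e i)|]
        rw [← Real.rpow_add this]
        congr 1; ring
    have h2 : ‖∑ i ∈ F, a i • e i‖ ^ r ≤ A := by
      rw [hnorm]
      refine Finset.sum_le_sum (fun i _ => ?_)
      have : |a i| ≤ |b (e i)| ^ (s - 1) := by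
        simp only [a]
        rw [abs_mul, abs_of_nonneg (a := |b (e i)| ^ (s-1)) (by positivity)]
        refine mul_le_of_le_one_left (by positivity) ?_
        rcases lt_trichotomy (b (e i)) 0 with h | h | h <;> simp [h]
      calc |a i| ^ r ≤ (|b (e i)| ^ (s - 1)) ^ r := Real.rpow_le_rpow (abs_nonneg _) this (by linarith)
        _ = |b (e i)| ^ s := by
          rw [← Real.rpow_mul (abs_nonneg _), hconj.symm.sub_one_mul_conj]
    have h3 : ‖∑ i ∈ F, a i • e i‖ ≤ A ^ (1/r) := by
      have := Real.rpow_le_rpow (by positivity) h2 (show 0 ≤ 1/r by positivity)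
      rwa [← Real.rpow_mul (norm_nonneg _), mul_one_div_cancel (by linarith), Real.rpow_one] at this
    have h4 : A ≤ ‖b‖ * A ^ (1/r) := by
      calc A = b (∑ i ∈ F, a i • e i) := h1.symm
        _ ≤ ‖b (∑ i ∈ F, a i • e i)‖ := le_abs_self _
        _ ≤ ‖b‖ * ‖∑ i ∈ F, a i • e i‖ := b.le_opNorm _
        _ ≤ _ := by gcongr
    rcases hA0.eq_or_lt with h | h
    · rw [← h]; positivity
    · have h5 : A ^ (1/s) ≤ ‖b‖ := by
        have h6 : A = A ^ (1/s) * A ^ (1/r) := by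
          rw [← Real.rpow_add h, one_div, one_div, hconj.symm.inv_add_inv_eq_one, Real.rpow_one]
        have h7 : 0 < A ^ (1/r) := by positivity
        exact le_of_mul_le_mul_right (h6.symm.le.trans h4) h7
      calc A = (A ^ (1/s)) ^ s := by
            rw [← Real.rpow_mul hA0, one_div_mul_cancel hs0.ne', Real.rpow_one]
        _ ≤ _ := Real.rpow_le_rpow (by positivity) h5 hs0.le
  refine ⟨⟨1/s, by positivity, e, ξ, u, ?_, ?_, ?_, ?_, ?_⟩⟩
  · intro θ
    have h1 : ‖u θ‖ ^ r ≤ 1 := by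
      simp only [u]
      rw [hnorm]
      simp only [hcr]
      exact frac_sum_le θ _ subset_rfl
    by_contra h
    push Not at h
    exact absurd h1 (not_le.mpr (Real.one_lt_rpow h (by linarith)))
  · intro x
    have h1 := (lp.hasSum_norm hr0 x).summable.tendsto_atTop_zero
    have h2 := h1.rpow_const (p := 1/r) (Or.inr (by positivity))
    rw [Real.zero_rpow (by positivity)] at h2
    rw [tendsto_zero_iff_norm_tendsto_zero]
    refine h2.congr (fun i => ?_)
    rw [← Real.rpow_mul (norm_nonneg _), mul_one_div_cancel (by linarith), Real.rpow_one]
    rfl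
  · intro θ hθ
    have h0 := tot_pos θ hθ
    calc _ = ∑ i ∈ θ.support, (θ i : ℝ) / tot θ := by
          refine Finset.sum_congr rfl (fun i hi => ?_)
          simp only [u]
          rw [hcoord _ _ _ hi]
          simp only [c]
          have : 0 < (θ i : ℝ) / tot θ := by
            have : 0 < θ i := Nat.pos_of_ne_zero (by simpa using hi)
            positivity
          rw [← Real.rpow_add this, one_div, one_div, hconj.symm.inv_add_inv_eq_one, Real.rpow_one]
      _ = 1 := by rw [← Finset.sum_div]; exact div_self h0.ne'
  · intro θ H hH x
    have h1 : ∑ i ∈ H, |((θ i : ℝ) / tot θ) ^ (1/s)| * |x i| ≤ _ :=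
      Real.inner_le_Lp_mul_Lq H _ _ hconj.symm
    simp only [abs_abs] at h1
    have h2 : ∑ i ∈ H, |((θ i : ℝ) / tot θ) ^ (1/s)| ^ s = (∑ i ∈ H, (θ i : ℝ)) / tot θ := by
      rw [Finset.sum_div]
      exact Finset.sum_congr rfl (fun i _ => rpow_inv_cancel (frac_nonneg θ i) hs0)
    rw [h2] at h1
    have h3 : (∑ i ∈ H, |x i| ^ r) ^ (1/r) ≤ ‖x‖ := by
      have h := lp.sum_rpow_le_norm_rpow hr0 x H
      have := Real.rpow_le_rpow (Finset.sum_nonneg (fun i _ => by positivity)) h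
        (show 0 ≤ 1/r by positivity)
      rw [← Real.rpow_mul (norm_nonneg _), mul_one_div_cancel (by linarith), Real.rpow_one] at this
      exact this
    calc _ ≤ ∑ i ∈ H, |((θ i : ℝ) / tot θ) ^ (1/s) * ξ i x| := Finset.abs_sum_le_sum_abs _ _
      _ = ∑ i ∈ H, |((θ i : ℝ) / tot θ) ^ (1/s)| * |x i| :=
        Finset.sum_congr rfl (fun i _ => abs_mul _ _)
      _ ≤ _ := h1
      _ ≤ _ := by
        have := tot_nonneg θ
        gcongr
  · intro b η hη t
    have := shrink_aux (β := fun i => b (e i)) (c := c)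
      (fun θ i => by
        rw [abs_of_nonneg (hc0 θ i)]
        exact Real.rpow_le_one (frac_nonneg θ i) (frac_le_one θ i) (by positivity))
      (fun ε hε => by
        obtain ⟨N0, hN0⟩ := vanish_aux (hbs b) (ε ^ s) (by positivity)
        refine ⟨N0, fun θ F hF hFN => ?_⟩
        have h1 := (hN0 F hFN).le
        rw [abs_of_nonneg (Finset.sum_nonneg (fun i _ => by positivity))] at h1
        have h2 : ∑ i ∈ F, |c θ i| * |b (e i)| ≤ _ := Real.inner_le_Lp_mul_Lq F _ _ hconj
        simp only [abs_abs, hcr] at h2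
        calc _ ≤ ∑ i ∈ F, |c θ i * b (e i)| := Finset.abs_sum_le_sum_abs _ _
          _ = ∑ i ∈ F, |c θ i| * |b (e i)| := Finset.sum_congr rfl (fun i _ => abs_mul _ _)
          _ ≤ _ := h2
          _ ≤ 1 ^ (1/r) * (ε ^ s) ^ (1/s) := by
            have h3 := frac_sum_le θ F hF
            have h4 : 0 ≤ ∑ i ∈ F, (θ i : ℝ) / tot θ :=
              Finset.sum_nonneg (fun i _ => frac_nonneg θ i)
            gcongr
          _ = ε := by
            rw [Real.one_rpow, one_mul, ← Real.rpow_mul hε.le, mul_one_div_cancel hs0.ne',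
              Real.rpow_one]) η hη t
    obtain ⟨N0, hN0⟩ := this
    refine ⟨N0, fun N hN θ hθ => ?_⟩
    have h := hN0 N hN θ hθ
    have h1 : b (u θ) = ∑ j ∈ θ.support, c θ j * b (e j) := by
      simp only [u]
      rw [map_sum]
      exact Finset.sum_congr rfl (fun i _ => by rw [map_smul, smul_eq_mul])
    rw [h1]; exact h

theorem model_c0 : Nonempty (Model (ZeroAtInftyContinuousMap ℕ ℝ)) := by
  classical
  let e : ℕ → ZeroAtInftyContinuousMap ℕ ℝ := fun i =>
    ⟨⟨fun j => if j = i then 1 else 0, continuous_of_discreteTopology⟩, by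
      rw [cocompact_eq_cofinite, Nat.cofinite_eq_atTop]
      refine tendsto_const_nhds.congr' ?_
      filter_upwards [eventually_gt_atTop i] with j hj
      simp [hj.ne']⟩
  have he : ∀ i j, e i j = if j = i then 1 else 0 := fun i j => rfl
  have hle : ∀ (x : ZeroAtInftyContinuousMap ℕ ℝ) i, |x i| ≤ ‖x‖ := by
    intro x i
    rw [← ZeroAtInftyContinuousMap.norm_toBCF_eq_norm]
    exact x.toBCF.norm_coe_le_norm i
  let ξ : ℕ → ZeroAtInftyContinuousMap ℕ ℝ →L[ℝ] ℝ := fun i =>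
    LinearMap.mkContinuous
      { toFun := fun x => x i
        map_add' := fun x y => rfl
        map_smul' := fun x y => rfl } 1 (fun x => by rw [one_mul]; exact hle x i)
  have hξ : ∀ i x, ξ i x = x i := fun i x => rfl
  have hcoord : ∀ (F : Finset ℕ) (a : ℕ → ℝ) j,
      ξ j (∑ i ∈ F, a i • e i) = if j ∈ F then a j else 0 := by
    intro F a j
    rw [map_sum]
    have : ∀ i ∈ F, ξ j (a i • e i) = if j = i then a i else 0 := by
      intro i _
      rw [map_smul, hξ, he, smul_eq_mul]
      split_ifs <;> simp
    rw [Finset.sum_congr rfl this]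
    simp
  have hnorm : ∀ (F : Finset ℕ) (a : ℕ → ℝ), (∀ i, |a i| ≤ 1) → ‖∑ i ∈ F, a i • e i‖ ≤ 1 := by
    intro F a ha
    rw [← ZeroAtInftyContinuousMap.norm_toBCF_eq_norm, BoundedContinuousFunction.norm_le zero_le_one]
    intro j
    have := hcoord F a j
    rw [hξ] at this
    change |(∑ i ∈ F, a i • e i) j| ≤ 1
    rw [this]
    split_ifs
    · exact ha j
    · simp
  have hbs : ∀ b : ZeroAtInftyContinuousMap ℕ ℝ →L[ℝ] ℝ, Summable (fun i => |b (e i)|) := by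
    intro b
    refine summable_of_sum_le (c := ‖b‖) (fun i => by positivity) (fun F => ?_)
    have h2 : ‖∑ i ∈ F, (SignType.sign (b (e i)) : ℝ) • e i‖ ≤ 1 := by
      refine hnorm F _ (fun i => ?_)
      rcases lt_trichotomy (b (e i)) 0 with h | h | h <;> simp [h]
    calc ∑ i ∈ F, |b (e i)| = b (∑ i ∈ F, (SignType.sign (b (e i)) : ℝ) • e i) := by
          rw [map_sum]
          exact Finset.sum_congr rfl (fun i _ => by rw [map_smul, smul_eq_mul, sign_mul_self])
      _ ≤ ‖b (∑ i ∈ F, (SignType.sign (b (e i)) : ℝ) • e i)‖ := le_abs_self _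
      _ ≤ ‖b‖ * ‖∑ i ∈ F, (SignType.sign (b (e i)) : ℝ) • e i‖ := b.le_opNorm _
      _ ≤ ‖b‖ * 1 := by gcongr
      _ = ‖b‖ := mul_one _
  refine ⟨⟨1, one_pos, e, ξ, fun θ => ∑ i ∈ θ.support, (1:ℝ) • e i, ?_, ?_, ?_, ?_, ?_⟩⟩
  · intro θ
    exact hnorm _ (fun _ => 1) (by simp)
  · intro x
    have := x.zero_at_infty'
    rw [cocompact_eq_cofinite, Nat.cofinite_eq_atTop] at this
    exact this
  · intro θ hθ
    have h0 := tot_pos θ hθ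
    calc _ = ∑ i ∈ θ.support, (θ i : ℝ) / tot θ := by
          refine Finset.sum_congr rfl (fun i hi => ?_)
          rw [hcoord _ (fun _ => 1), if_pos hi, Real.rpow_one, mul_one]
      _ = 1 := by rw [← Finset.sum_div]; exact div_self h0.ne'
  · intro θ H hH x
    simp only [Real.rpow_one]
    calc _ ≤ ∑ i ∈ H, |((θ i : ℝ) / tot θ) * ξ i x| := Finset.abs_sum_le_sum_abs _ _
      _ ≤ ∑ i ∈ H, (θ i : ℝ) / tot θ * ‖x‖ := by
        refine Finset.sum_le_sum (fun i _ => ?_)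
        rw [abs_mul, abs_of_nonneg (frac_nonneg θ i)]
        exact mul_le_mul_of_nonneg_left (hle x i) (frac_nonneg θ i)
      _ = _ := by rw [← Finset.sum_mul, Finset.sum_div]
  · intro b η hη t
    have := shrink_aux (β := fun i => b (e i)) (c := fun _ _ => 1) (fun θ i => by simp)
      (fun ε hε => by
        obtain ⟨N0, hN0⟩ := vanish_aux (hbs b) ε hε
        refine ⟨N0, fun θ F hF hFN => ?_⟩
        have h1 := (hN0 F hFN).le
        simp only [one_mul]
        exact (Finset.abs_sum_le_sum_abs _ _).trans ((le_abs_self _).trans h1)) η hη t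
    obtain ⟨N0, hN0⟩ := this
    refine ⟨N0, fun N hN θ hθ => ?_⟩
    have h := hN0 N hN θ hθ
    have h1 : b (∑ i ∈ θ.support, (1:ℝ) • e i) = ∑ j ∈ θ.support, 1 * b (e j) := by
      rw [map_sum]
      exact Finset.sum_congr rfl (fun i _ => by rw [map_smul, smul_eq_mul])
    rw [h1]; exact h
end models

section chain
variable {E X : Type*} [NormedAddCommGroup E] [NormedSpace ℝ E] [CompleteSpace E]
  [NormedAddCommGroup X] [NormedSpace ℝ X]

def gens (T : Set (Finset ℕ) → X →L[ℝ] X) (𝒬 : Set (Set (Finset ℕ))) : Set (X →L[ℝ] X) :=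
  {R | ∃ P ∈ 𝒬, ∃ A B : X →L[ℝ] X, R = B.comp ((T P).comp A)}

noncomputable def idl (T : Set (Finset ℕ) → X →L[ℝ] X) (𝒬 : Set (Set (Finset ℕ))) :
    Set (X →L[ℝ] X) :=
  ((Submodule.span ℝ (gens T 𝒬)).topologicalClosure : Set (X →L[ℝ] X))

theorem idl_mono (T : Set (Finset ℕ) → X →L[ℝ] X) {𝒬 𝒬' : Set (Set (Finset ℕ))} (h : 𝒬 ⊆ 𝒬') :
    idl T 𝒬 ⊆ idl T 𝒬' := by
  refine Submodule.topologicalClosure_mono (Submodule.span_mono ?_)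
  rintro R ⟨P, hP, A, B, rfl⟩
  exact ⟨P, h hP, A, B, rfl⟩

theorem mem_idl (T : Set (Finset ℕ) → X →L[ℝ] X) {𝒬 : Set (Set (Finset ℕ))} {P : Set (Finset ℕ)}
    (h : P ∈ 𝒬) : T P ∈ idl T 𝒬 := by
  refine Submodule.le_topologicalClosure _ (Submodule.subset_span ?_)
  exact ⟨P, h, ContinuousLinearMap.id ℝ X, ContinuousLinearMap.id ℝ X, by ext; rfl⟩

theorem idl_ideal (T : Set (Finset ℕ) → X →L[ℝ] X) (𝒬 : Set (Set (Finset ℕ))) :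
    IsClosedOperatorIdeal (idl T 𝒬) := by
  refine ⟨Submodule.isClosed_topologicalClosure _, Submodule.zero_mem _,
    fun S hS R hR => Submodule.add_mem _ hS hR, fun c R hR => Submodule.smul_mem _ c hR, ?_⟩
  intro R hR A B
  have hcont : Continuous (fun R : X →L[ℝ] X => B.comp (R.comp A)) := by fun_prop
  have hmaps : Set.MapsTo (fun R : X →L[ℝ] X => B.comp (R.comp A))
      (Submodule.span ℝ (gens T 𝒬) : Set (X →L[ℝ] X)) (Submodule.span ℝ (gens T 𝒬)) := by
    intro R hR
    refine Submodule.span_induction (p := fun R _ => B.comp (R.comp A) ∈ Submodule.span ℝ (gens T 𝒬))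
      ?_ ?_ ?_ ?_ hR
    · rintro _ ⟨P, hP, A', B', rfl⟩
      exact Submodule.subset_span ⟨P, hP, A'.comp A, B.comp B', by ext; rfl⟩
    · simp
    · intro x y _ _ hx hy
      have : B.comp ((x + y).comp A) = B.comp (x.comp A) + B.comp (y.comp A) := by
        ext; simp
      rw [this]
      exact Submodule.add_mem _ hx hy
    · intro a x _ hx
      have : B.comp ((a • x).comp A) = a • B.comp (x.comp A) := by
        ext; simp
      rw [this]
      exact Submodule.smul_mem _ _ hx
  exact hmaps.closure hcont hR

theorem not_mem_idl (M : Model E) (J1 : L1 →L[ℝ] X) (Q1 : X →L[ℝ] L1)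
    (h1 : Q1.comp J1 = ContinuousLinearMap.id ℝ L1) (JE : E →L[ℝ] X) (QE : X →L[ℝ] E)
    (hE : QE.comp JE = ContinuousLinearMap.id ℝ E) (f : ℕ → Set (Finset ℕ)) (hf : ∀ i, WFam (f i))
    (𝒬 : Set (Set (Finset ℕ))) (h𝒬 : 𝒬 ⊆ Set.range f) :
    JE.comp ((M.S (newFam f)).comp Q1) ∉ idl (fun P => JE.comp ((M.S P).comp Q1)) 𝒬 := by
  intro hmem
  have h1' : ∀ z, Q1 (J1 z) = z := fun z => by
    have := congrArg (fun g => g z) h1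
    simpa using this
  have hE' : ∀ z, QE (JE z) = z := fun z => by
    have := congrArg (fun g => g z) hE
    simpa using this
  have hmem' : JE.comp ((M.S (newFam f)).comp Q1) ∈
    closure (Submodule.span ℝ (gens (fun P => JE.comp ((M.S P).comp Q1)) 𝒬) : Set (X →L[ℝ] X)) := hmem
  have hcont : Continuous (fun R : X →L[ℝ] X => QE.comp (R.comp J1)) := by fun_prop
  have hmem2 := map_mem_closure (t := (fun R : X →L[ℝ] X => QE.comp (R.comp J1)) ''
      (Submodule.span ℝ (gens (fun P => JE.comp ((M.S P).comp Q1)) 𝒬) : Set (X →L[ℝ] X)))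
      hcont hmem' (fun R hR => ⟨R, hR, rfl⟩)
  rw [Metric.mem_closure_iff] at hmem2
  obtain ⟨_, ⟨R, hR, rfl⟩, hd⟩ := hmem2 (1/4) (by norm_num)
  have e0 : QE.comp ((JE.comp ((M.S (newFam f)).comp Q1)).comp J1) = M.S (newFam f) := by
    ext1 z
    simp [h1', hE']
  rw [e0, dist_eq_norm] at hd
  obtain ⟨K, c, g, hg⟩ := Submodule.mem_span_set'.mp hR
  choose P hP A B hAB using fun i => (g i).2
  choose k hk using fun i => h𝒬 (hP i)
  have hcore := core M hf k (fun i => c i • (QE.comp ((B i).comp JE)))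
    (fun i => Q1.comp ((A i).comp J1))
  have e1 : ∑ i, (c i • (QE.comp ((B i).comp JE))).comp
      ((M.S (f (k i))).comp (Q1.comp ((A i).comp J1))) = QE.comp (R.comp J1) := by
    rw [← hg]
    ext1 z
    simp [sum_apply, hAB, hk, map_sum]
  rw [e1] at hcore
  exact absurd hd (not_lt.mpr hcore)

theorem chain_exists (M : Model E) (J1 : L1 →L[ℝ] X) (Q1 : X →L[ℝ] L1)
    (h1 : Q1.comp J1 = ContinuousLinearMap.id ℝ L1) (JE : E →L[ℝ] X) (QE : X →L[ℝ] E)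
    (hE : QE.comp JE = ContinuousLinearMap.id ℝ E) :
    ∃ C : Set (Set (X →L[ℝ] X)),
      (∀ I ∈ C, IsClosedOperatorIdeal I) ∧ IsChain (· ⊆ ·) C ∧ ¬ C.Countable := by
  classical
  let T : Set (Finset ℕ) → X →L[ℝ] X := fun P => JE.comp ((M.S P).comp Q1)
  let α := {𝒬 : Set (Set (Finset ℕ)) // 𝒬.Countable ∧ ∀ P ∈ 𝒬, WFam P}
  let J : α → Set (X →L[ℝ] X) := fun a => idl T a.1
  let r : α → α → Prop := fun a b => J a ⊆ J b
  have hmax : IsMaxChain r (maxChain r) := maxChain_spec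
  refine ⟨J '' maxChain r, ?_, ?_, ?_⟩
  · rintro _ ⟨a, -, rfl⟩
    exact idl_ideal T a.1
  · rintro _ ⟨a, ha, rfl⟩ _ ⟨b, hb, rfl⟩ hne
    exact hmax.1 ha hb (fun h => hne (by rw [h]))
  · intro hcount
    have hsel : ∀ I : (J '' maxChain r), ∃ a ∈ maxChain r, J a = I.1 := fun I => I.2
    choose sel hsel1 hsel2 using hsel
    have : Countable (J '' maxChain r) := hcount.to_subtype
    let 𝒬s : Set (Set (Finset ℕ)) := ⋃ I, (sel I).1
    have hc : 𝒬s.Countable := Set.countable_iUnion (fun I => (sel I).2.1)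
    have hw : ∀ P ∈ 𝒬s, WFam P := by
      intro P hP
      obtain ⟨I, hI⟩ := Set.mem_iUnion.mp hP
      exact (sel I).2.2 P hI
    have hempty : WFam ∅ := fun Γ _ => ⟨∅, by simp, by simp⟩
    obtain ⟨f, hf⟩ := (hc.insert ∅).exists_eq_range (Set.insert_nonempty _ _)
    have hfw : ∀ i, WFam (f i) := by
      intro i
      have : f i ∈ insert ∅ 𝒬s := by rw [hf]; exact ⟨i, rfl⟩
      rcases this with h | h
      · rw [h]; exact hempty
      · exact hw _ h
    let b : α := ⟨insert (newFam f) 𝒬s, hc.insert _, by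
      rintro P (rfl | h)
      · exact newFam_wf f hfw
      · exact hw P h⟩
    have hup : ∀ a ∈ maxChain r, J a ⊆ idl T 𝒬s := by
      intro a ha
      have := hsel2 ⟨J a, a, ha, rfl⟩
      simp only at this
      rw [← this]
      exact idl_mono T (Set.subset_iUnion (fun I => (sel I).1) _)
    have hup2 : idl T 𝒬s ⊆ J b := idl_mono T (Set.subset_insert _ _)
    have hch : IsChain r (insert b (maxChain r)) := by
      refine hmax.1.insert (fun a ha _ => Or.inr ?_)
      exact (hup a ha).trans hup2
    have hb : b ∈ maxChain r := by
      have := hmax.2 hch (Set.subset_insert _ _)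
      rw [this]; exact Set.mem_insert _ _
    have h3 : T (newFam f) ∈ idl T 𝒬s :=
      hup b hb (mem_idl T (Set.mem_insert _ _))
    exact not_mem_idl M J1 Q1 h1 JE QE hE f hfw 𝒬s
      (by rw [← hf]; exact Set.subset_insert _ _) h3
end chain
end auxiliary

/-- Suppose a Banach space `X` contains a complemented copy of `ℓ₁` and a
complemented copy of `ℓ_q` for some `1 < q < ∞` (or, interpreting `ℓ_∞` as `c₀`, a
complemented copy of `c₀`).  Then `L(X)` admits an uncountable chain of closed ideals. -/
theorem stmt17 {X : Type*} [NormedAddCommGroup X] [NormedSpace ℝ X] [CompleteSpace X]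
    (h1 : ComplementedCopy (lp (fun _ : ℕ => ℝ) 1) X)
    (h2 : (∃ (q : ENNReal) (hq1 : 1 < q), q < ⊤ ∧
            (haveI : Fact (1 ≤ q) := ⟨hq1.le⟩
             ComplementedCopy (lp (fun _ : ℕ => ℝ) q) X)) ∨
          ComplementedCopy (ZeroAtInftyContinuousMap ℕ ℝ) X) :
    ∃ C : Set (Set (X →L[ℝ] X)),
      (∀ I ∈ C, IsClosedOperatorIdeal I) ∧ IsChain (· ⊆ ·) C ∧ ¬ C.Countable := by
  obtain ⟨J1, Q1, hJ1⟩ := h1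
  rcases h2 with ⟨q, hq1, hq, JE, QE, hE⟩ | ⟨JE, QE, hE⟩
  · have : Fact (1 ≤ q) := ⟨hq1.le⟩
    obtain ⟨M⟩ := model_lp q hq1 hq
    exact chain_exists M J1 Q1 hJ1 JE QE hE
  · obtain ⟨M⟩ := model_c0
    exact chain_exists M J1 Q1 hJ1 JE QE hE
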